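/- Assume N = 3 and that χ_σ corresponds to the character 1⊗1⊗η of (k_F^×)³, i.e. χ_σ(i) = η(third diagonal entry of red(i)), where η is a nontrivial character of k_F^× (so W(χ_σ) = {Id, ω_1}). For a ∈ S_{Id} ∪ S_{ω_1} write f_a = f_{Id,a} if a ∈ S_{Id} and f_a = f_{ω_1,a} if a ∈ S_{ω_1}. Then: (1) for a ∈ S_{Id}: f_a|(T_{ω_1·t_{(0,−1)}} T_{ω_1}) = f_{(a_1−1,a_2)} = f_a|T_{t_{(−1,0)}} and f_a|T_{ω_1·t_{(0,−1)}}² = f_{(a_1−1,a_2−1)} = f_a|T_{t_{(−1,−1)}}; (2) for a ∈ S_{ω_1}: f_a|(T_{ω_1} T_{ω_1·t_{(0,−1)}}) = f_{(a_1,a_2−1)} = f_a|T_{t_{(0,−1)}} and f_a|T_{ω_1·t_{(0,−1)}}² = f_{(a_1−1,a_2−1)} = f_a|T_{t_{(−1,−1)}}. -/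

import Mathlib

open Matrix

noncomputable section

namespace IH

variable (p : ℕ) [Fact p.Prime]

/-- `\bar{𝔽}_p`, an algebraic closure of the residue field. -/
abbrev kb := AlgebraicClosure (ZMod p)

variable (N : ℕ)

/-- `G = GL_N(F)` with `F = ℚ_p`. -/
abbrev GG := GL (Fin N) ℚ_[p]
/-- `GL_N(O_F)` (as an abstract group, mapping onto `K ⊆ G`). -/
abbrev MM := GL (Fin N) ℤ_[p]
/-- `GL_N(k_F)`. -/
abbrev Gk := GL (Fin N) (ZMod p)

/-- The inclusion `GL_N(O_F) → GL_N(F)`. -/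
def iotaM : MM p N →* GG p N := Matrix.GeneralLinearGroup.map (PadicInt.Coe.ringHom)

/-- The reduction map `red : GL_N(O_F) → GL_N(k_F)`. -/
def redM : MM p N →* Gk p N := Matrix.GeneralLinearGroup.map (PadicInt.toZMod)

/-- Elements of `GL_N(O_F)` whose reduction is upper triangular: the Iwahori condition. -/
def Ipre : Set (MM p N) :=
  {m | ∀ i j : Fin N, j < i → ((redM p N m : Matrix (Fin N) (Fin N) (ZMod p)) i j = 0)}

/-- Elements of `GL_N(O_F)` whose reduction is upper triangular unipotent: pro-p Iwahori. -/
def I1pre : Set (MM p N) :=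
  {m | m ∈ Ipre p N ∧ ∀ i : Fin N, ((redM p N m : Matrix (Fin N) (Fin N) (ZMod p)) i i = 1)}

/-- Elements of `GL_N(O_F)` reducing to the identity: `K_1 = ker red`. -/
def K1pre : Set (MM p N) := {m | redM p N m = 1}

/-- `K = GL_N(O_F)` as a subset of `G`. -/
def Kset : Set (GG p N) := Set.range (iotaM p N)
/-- The Iwahori subgroup `I ⊆ G`. -/
def Iset : Set (GG p N) := iotaM p N '' Ipre p N
/-- The pro-p Iwahori subgroup `I_1 ⊆ G`. -/
def I1set : Set (GG p N) := iotaM p N '' I1pre p N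
/-- `K_1 ⊆ G`. -/
def K1set : Set (GG p N) := iotaM p N '' K1pre p N

/-- The uniformizer `ϖ = p` as a unit of `ℚ_p`. -/
def pU : ℚ_[p]ˣ :=
  Units.mk0 (p : ℚ_[p]) (by
    have h := (Fact.out : p.Prime).ne_zero
    exact_mod_cast Nat.cast_ne_zero.mpr h)

/-- Scalar matrices as elements of `G`. -/
def scalarGL (u : ℚ_[p]ˣ) : GG p N :=
  Units.map (algebraMap ℚ_[p] (Matrix (Fin N) (Fin N) ℚ_[p])).toMonoidHom u

/-- The central element `ϖ^n · Id`. -/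
def piSc (n : ℤ) : GG p N := scalarGL p N (pU p ^ n)

/-- Invertible diagonal matrices. -/
def diagGL (d : Fin N → ℚ_[p]ˣ) : GG p N where
  val := Matrix.diagonal fun i => (d i : ℚ_[p])
  inv := Matrix.diagonal fun i => (((d i)⁻¹ : ℚ_[p]ˣ) : ℚ_[p])
  val_inv := by
    rw [Matrix.diagonal_mul_diagonal]
    simp
  inv_val := by
    rw [Matrix.diagonal_mul_diagonal]
    simp

/-- extend `a ∈ ℤ^{N-1}` by `0` in the last coordinate. -/
def expo (a : Fin (N - 1) → ℤ) : Fin N → ℤ :=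
  fun i => if h : (i : ℕ) < N - 1 then a ⟨i, h⟩ else 0

/-- `t_a = diag(ϖ^{a_1}, …, ϖ^{a_{N-1}}, 1)`. -/
def tGL (a : Fin (N - 1) → ℤ) : GG p N :=
  diagGL p N fun i => pU p ^ (expo N a i)

/-- The permutation matrix of `σ` (with `permGL σ · e_j = e_{σ j}`, so that
`permGL` is a group homomorphism). -/
def permGL (σ : Equiv.Perm (Fin N)) : GG p N where
  val := (σ⁻¹).permMatrix ℚ_[p]
  inv := σ.permMatrix ℚ_[p]
  val_inv := by
    show ((σ⁻¹).toPEquiv.toMatrix : Matrix (Fin N) (Fin N) ℚ_[p]) * σ.toPEquiv.toMatrix = 1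
    rw [← PEquiv.toMatrix_trans, ← Equiv.toPEquiv_trans]
    simp only [Equiv.self_trans_symm, Equiv.symm_trans_self, Equiv.Perm.inv_def]
    rw [Equiv.toPEquiv_refl, PEquiv.toMatrix_refl]
  inv_val := by
    show (σ.toPEquiv.toMatrix : Matrix (Fin N) (Fin N) ℚ_[p]) * (σ⁻¹).toPEquiv.toMatrix = 1
    rw [← PEquiv.toMatrix_trans, ← Equiv.toPEquiv_trans]
    simp only [Equiv.self_trans_symm, Equiv.symm_trans_self, Equiv.Perm.inv_def]
    rw [Equiv.toPEquiv_refl, PEquiv.toMatrix_refl]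

/-- `ω t_a`. -/
def wS (σ : Equiv.Perm (Fin N)) (a : Fin (N - 1) → ℤ) : GG p N :=
  permGL p N σ * tGL p N a

/-- The permutation `ω₂` (as a matrix: first row block `(0, I_{N-1})`, last row `(1,0,…,0)`). -/
def w2 : Equiv.Perm (Fin N) := (finRotate N)⁻¹

/-- `γ = ω₂ · diag(ϖ, I_{N-1})`. -/
def gammaGL : GG p N :=
  permGL p N (w2 N) * tGL p N fun i => if (i : ℕ) = 0 then 1 else 0

/-- `S_ω = {a ∈ ℤ^{N-1} : (ω t_a) I (ω t_a)⁻¹ ∩ K ⊆ I}`. -/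
def Sset (σ : Equiv.Perm (Fin N)) : Set (Fin (N - 1) → ℤ) :=
  {a | ∀ g ∈ Iset p N,
    wS p N σ a * g * (wS p N σ a)⁻¹ ∈ Kset p N →
    wS p N σ a * g * (wS p N σ a)⁻¹ ∈ Iset p N}

/-- The unit of `k_F^×` attached to a nonzero element of `k_F` (junk value `1` at `0`). -/
def unitOf (x : ZMod p) : (ZMod p)ˣ :=
  if h : x = 0 then 1 else Units.mk0 x h

/-- The diagonal of the reduction of `m`, as an `N`-tuple of units of `k_F`. -/
def diagOf (m : MM p N) : Fin N → (ZMod p)ˣ :=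
  fun i => unitOf p ((redM p N m : Matrix (Fin N) (Fin N) (ZMod p)) i i)

/-- The transformation rule for functions in `H_{IZ}(χ)`, where the character `χ` of `I`
is given by the character `ξ` of the torus `(k_F^×)^N` through the diagonal of the
reduction, extended to `IZ` by `χ(ϖ) = 1`. -/
def HTransf (ξ : (Fin N → (ZMod p)ˣ) →* (kb p)ˣ) (φ : GG p N → kb p) : Prop :=
  ∀ (n₁ n₂ : ℤ) (m₁ m₂ : MM p N), m₁ ∈ Ipre p N → m₂ ∈ Ipre p N → ∀ g : GG p N,
    φ (piSc p N n₁ * iotaM p N m₁ * g * (piSc p N n₂ * iotaM p N m₂)) =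
      (ξ (diagOf p N m₁) : kb p) * (ξ (diagOf p N m₂) : kb p) * φ g

/-- `φ` is supported on the double coset `IZ x I`. -/
def SuppDouble (φ : GG p N → kb p) (x : GG p N) : Prop :=
  ∀ g : GG p N, φ g ≠ 0 → ∃ (n : ℤ) (m₁ m₂ : MM p N), m₁ ∈ Ipre p N ∧ m₂ ∈ Ipre p N ∧
    g = piSc p N n * iotaM p N m₁ * x * iotaM p N m₂

/-- Membership in `H_{IZ}(χ)`: the transformation rule together with support in
finitely many double cosets `IZ g I`. -/
def HMem (ξ : (Fin N → (ZMod p)ˣ) →* (kb p)ˣ) (φ : GG p N → kb p) : Prop :=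
  HTransf p N ξ φ ∧
  ∃ S : Finset (GG p N), ∀ g : GG p N, φ g ≠ 0 →
    ∃ s ∈ S, ∃ (n : ℤ) (m₁ m₂ : MM p N), m₁ ∈ Ipre p N ∧ m₂ ∈ Ipre p N ∧
      g = piSc p N n * iotaM p N m₁ * s * iotaM p N m₂

section Rep

variable {V : Type} [AddCommGroup V] [Module (kb p) V]

/-- `σ` (here `ρ`) is irreducible. -/
def IsIrred (ρ : Representation (kb p) (Gk p N) V) : Prop :=
  (∃ v : V, v ≠ 0) ∧
  ∀ W : Submodule (kb p) V, (∀ g v, v ∈ W → ρ g v ∈ W) → W = ⊥ ∨ W = ⊤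

/-- Membership in the compact induction `ind_{KZ}^G σ`: left `KZ`-equivariance
(where `ϖ` acts trivially), support in finitely many cosets `KZ g`, and smoothness. -/
def IndMem (ρ : Representation (kb p) (Gk p N) V) (f : GG p N → V) : Prop :=
  (∀ (n : ℤ) (m : MM p N) (g : GG p N),
      f (piSc p N n * iotaM p N m * g) = ρ (redM p N m) (f g)) ∧
  (∃ S : Finset (GG p N), ∀ g : GG p N, f g ≠ 0 →
      ∃ s ∈ S, ∃ (n : ℤ) (m : MM p N), g = piSc p N n * iotaM p N m * s) ∧
  (∃ U : Subgroup (GG p N), IsOpen (U : Set (GG p N)) ∧ ∀ u ∈ U, ∀ g, f (g * u) = f g)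

/-- `f` is invariant under right translation by `I_1`. -/
def IsI1Inv (f : GG p N → V) : Prop :=
  ∀ u ∈ I1set p N, ∀ g, f (g * u) = f g

/-- The defining property of the standard function `f_{ω,a}`: an `I_1`-invariant member of
`ind_{KZ}^G σ` supported on `KZ t_a I_1` with value `v₀` at `ω t_a`. -/
def IsStd (ρ : Representation (kb p) (Gk p N) V) (v₀ : V)
    (σp : Equiv.Perm (Fin N)) (a : Fin (N - 1) → ℤ) (f : GG p N → V) : Prop :=
  IndMem p N ρ f ∧ IsI1Inv p N f ∧
  (∀ g : GG p N, f g ≠ 0 → ∃ (n : ℤ) (m : MM p N) (u : GG p N), u ∈ I1set p N ∧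
      g = piSc p N n * iotaM p N m * tGL p N a * u) ∧
  f (wS p N σp a) = v₀

/-- `R` is a set of representatives for `I_1/(I_1 ∩ g⁻¹ I_1 g)`. -/
def IsRepSet (g : GG p N) (R : Finset (GG p N)) : Prop :=
  (↑R ⊆ I1set p N) ∧
  ∀ x ∈ I1set p N, ∃! r : GG p N, r ∈ R ∧
    (r⁻¹ * x ∈ I1set p N ∧ g * (r⁻¹ * x) * g⁻¹ ∈ I1set p N)

/-- The Hecke operator: `f|T_g = ∑_{r} (r g⁻¹)·f`, where `(h·f)(x) = f(xh)`. -/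
def hk (g : GG p N) (R : Finset (GG p N)) (f : GG p N → V) : GG p N → V :=
  fun x => ∑ r ∈ R, f (x * r * g⁻¹)

end Rep


/-- The defining property of `f_a` for `a ∈ S_{Id} ∪ S_{ω₁}` (semi-regular case). -/
def IsFsr (p : ℕ) [Fact p.Prime] {V : Type} [AddCommGroup V] [Module (kb p) V]
    (ρ : Representation (kb p) (Gk p 3) V) (v₀ : V) (a : Fin 2 → ℤ)
    (f : GG p 3 → V) : Prop :=
  (a ∈ Sset p 3 1 ∧ IsStd p 3 ρ v₀ 1 a f) ∨
  (a ∈ Sset p 3 (Equiv.swap (0 : Fin 3) 1) ∧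
    IsStd p 3 ρ v₀ (Equiv.swap (0 : Fin 3) 1) a f)

section Aux

variable {p}

lemma toZMod_eq_zero_iff (x : ℤ_[p]) :
    PadicInt.toZMod x = 0 ↔ (p : ℚ_[p])⁻¹ * x ∈ PadicInt.subring p := by
  have hp : (p : ℚ_[p]) ≠ 0 := by exact_mod_cast (Fact.out : p.Prime).ne_zero
  rw [← RingHom.mem_ker, PadicInt.ker_toZMod, PadicInt.maximalIdeal_eq_span_p,
    Ideal.mem_span_singleton]
  constructor
  · rintro ⟨c, rfl⟩
    have : (p : ℚ_[p])⁻¹ * ((p * c : ℤ_[p]) : ℚ_[p]) = c := by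
      push_cast
      field_simp
    rw [this]
    exact c.2
  · intro h
    let c : ℤ_[p] := ⟨_, h⟩
    have hc : ((p * c : ℤ_[p]) : ℚ_[p]) = x := by
      rw [PadicInt.coe_mul, PadicInt.coe_natCast]
      exact mul_inv_cancel_left₀ hp _
    exact ⟨c, (PadicInt.ext hc).symm⟩

lemma toZMod_eq_one_iff (x : ℤ_[p]) :
    PadicInt.toZMod x = 1 ↔ (p : ℚ_[p])⁻¹ * (x - 1) ∈ PadicInt.subring p := by
  rw [← sub_eq_zero, ← map_one (PadicInt.toZMod (p := p)), ← map_sub, toZMod_eq_zero_iff]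
  push_cast
  rfl

lemma isUnit_of_toZMod_eq_one {x : ℤ_[p]} (h : PadicInt.toZMod x = 1) : IsUnit x := by
  by_contra hx
  have h2 : x ∈ IsLocalRing.maximalIdeal ℤ_[p] := (IsLocalRing.mem_maximalIdeal x).2 hx
  rw [← PadicInt.ker_toZMod, RingHom.mem_ker, h] at h2
  exact one_ne_zero h2

/-- Entrywise description of the matrices in the pro-`p` Iwahori subgroup. -/
def IsProPIwahori (M : Matrix (Fin 3) (Fin 3) ℚ_[p]) : Prop :=
  (∀ i j, M i j ∈ PadicInt.subring p) ∧
  (∀ i j, j < i → (p : ℚ_[p])⁻¹ * M i j ∈ PadicInt.subring p) ∧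
  ∀ i, (p : ℚ_[p])⁻¹ * (M i i - 1) ∈ PadicInt.subring p

lemma iotaM_apply (m : MM p 3) (i j : Fin 3) :
    (iotaM p 3 m : Matrix (Fin 3) (Fin 3) ℚ_[p]) i j = ((m : Matrix (Fin 3) (Fin 3) ℤ_[p]) i j) :=
  rfl

lemma redM_apply (m : MM p 3) (i j : Fin 3) :
    (redM p 3 m : Matrix (Fin 3) (Fin 3) (ZMod p)) i j =
      PadicInt.toZMod ((m : Matrix (Fin 3) (Fin 3) ℤ_[p]) i j) :=
  rfl

lemma isProPIwahori_iotaM_iff (m : MM p 3) :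
    IsProPIwahori (iotaM p 3 m : Matrix (Fin 3) (Fin 3) ℚ_[p]) ↔ m ∈ I1pre p 3 := by
  have key : ∀ i, (p : ℚ_[p])⁻¹ * ((iotaM p 3 m : Matrix (Fin 3) (Fin 3) ℚ_[p]) i i - 1) ∈
      PadicInt.subring p ↔ (redM p 3 m : Matrix (Fin 3) (Fin 3) (ZMod p)) i i = 1 :=
    fun i => (toZMod_eq_one_iff _).symm
  exact ⟨fun h => ⟨fun i j hij => (toZMod_eq_zero_iff _).2 (h.2.1 i j hij),
      fun i => (key i).1 (h.2.2 i)⟩,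
    fun h => ⟨fun i j => Subtype.property _, fun i j hij => (toZMod_eq_zero_iff _).1 (h.1 i j hij),
      fun i => (key i).2 (h.2 i)⟩⟩

lemma mem_I1set_iff (g : GG p 3) :
    g ∈ I1set p 3 ↔ IsProPIwahori (g : Matrix (Fin 3) (Fin 3) ℚ_[p]) := by
  constructor
  · rintro ⟨m, hm, rfl⟩
    exact (isProPIwahori_iotaM_iff m).2 hm
  · intro h
    let A : Matrix (Fin 3) (Fin 3) ℤ_[p] := fun i j => ⟨g i j, h.1 i j⟩
    have hlow : ∀ i j, j < i → PadicInt.toZMod (A i j) = 0 := fun i j hij =>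
      (toZMod_eq_zero_iff _).2 (h.2.1 i j hij)
    have hdiag : ∀ i, PadicInt.toZMod (A i i) = 1 := fun i =>
      (toZMod_eq_one_iff _).2 (h.2.2 i)
    have hdet : IsUnit A.det := by
      apply isUnit_of_toZMod_eq_one
      rw [RingHom.map_det, Matrix.det_of_isUpperTriangular]
      · simp [hdiag]
      · intro i j hij
        exact hlow i j hij
    have hA : iotaM p 3 (A.nonsingInvUnit hdet) = g := by
      apply Units.ext
      ext i j
      rfl
    refine ⟨A.nonsingInvUnit hdet, ?_, hA⟩
    rw [← isProPIwahori_iotaM_iff, hA]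
    exact h

lemma one_mem_I1set : (1 : GG p 3) ∈ I1set p 3 :=
  ⟨1, ⟨fun i j hij => by simp [Matrix.one_apply_ne hij.ne'], fun i => by simp⟩, map_one _⟩

lemma mul_mem_I1set {g h : GG p 3} (hg : g ∈ I1set p 3) (hh : h ∈ I1set p 3) :
    g * h ∈ I1set p 3 := by
  obtain ⟨m, ⟨hm, hm'⟩, rfl⟩ := hg
  obtain ⟨n, ⟨hn, hn'⟩, rfl⟩ := hh
  refine ⟨m * n, ⟨?_, ?_⟩, map_mul _ _ _⟩
  · intro i j hij
    rw [map_mul, Units.val_mul]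
    exact Matrix.BlockTriangular.mul (b := id) (fun _ _ h => hm _ _ h) (fun _ _ h => hn _ _ h) hij
  · intro i
    have h10 := hm 1 0 (by decide)
    have h20 := hm 2 0 (by decide)
    have h21 := hm 2 1 (by decide)
    have k10 := hn 1 0 (by decide)
    have k20 := hn 2 0 (by decide)
    have k21 := hn 2 1 (by decide)
    rw [map_mul, Units.val_mul, Matrix.mul_apply, Fin.sum_univ_three]
    fin_cases i <;> simp [h10, h20, h21, k10, k20, k21, hm', hn']

lemma inv_mem_I1set {g : GG p 3} (hg : g ∈ I1set p 3) : g⁻¹ ∈ I1set p 3 := by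
  obtain ⟨m, ⟨hm, hm'⟩, rfl⟩ := hg
  have h10 := hm 1 0 (by decide)
  have h20 := hm 2 0 (by decide)
  have h21 := hm 2 1 (by decide)
  have hmul : ∀ i j, ((redM p 3 m : Matrix (Fin 3) (Fin 3) (ZMod p)) *
      (redM p 3 m⁻¹ : Matrix (Fin 3) (Fin 3) (ZMod p))) i j =
      (1 : Matrix (Fin 3) (Fin 3) (ZMod p)) i j := by
    intro i j
    rw [← Units.val_mul, ← map_mul, mul_inv_cancel, map_one, Units.val_one]
  simp only [Matrix.mul_apply, Fin.sum_univ_three] at hmul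
  have e2 := hmul 2
  have e1 := hmul 1
  have e0 := hmul 0
  simp only [h10, h20, h21, hm', zero_mul, one_mul, zero_add] at e0 e1 e2
  have b20 := e2 0
  have b21 := e2 1
  have b22 := e2 2
  have b10 := e1 0
  have b11 := e1 1
  have b00 := e0 0
  rw [b20] at b10 b00
  rw [b21] at b11
  simp only [ne_eq, Fin.reduceEq, not_false_eq_true, Matrix.one_apply_ne, mul_zero,
    add_zero] at b10 b11 b00
  rw [b10] at b00
  simp only [ne_eq, Fin.reduceEq, not_false_eq_true, Matrix.one_apply_ne, Matrix.one_apply_eq,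
    mul_zero, add_zero] at b00 b10 b11 b20 b21 b22
  refine ⟨m⁻¹, ⟨?_, ?_⟩, map_inv _ _⟩
  · intro i j hij
    fin_cases i <;> fin_cases j <;> first | assumption | (exact absurd hij (by decide))
  · intro i
    fin_cases i <;> assumption

end Aux

section Hecke

variable {p}
variable {V : Type} [AddCommGroup V] [Module (kb p) V]

/-- `f` is `K Z`-equivariant, `I_1`-invariant, supported on `K Z x I_1`, with value `v₀` at `x`. -/
def IsStdAt (ρ : Representation (kb p) (Gk p 3) V) (v₀ : V) (x : GG p 3) (f : GG p 3 → V) : Prop :=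
  (∀ (n : ℤ) (m : MM p 3) (g : GG p 3),
      f (piSc p 3 n * iotaM p 3 m * g) = ρ (redM p 3 m) (f g)) ∧
  IsI1Inv p 3 f ∧
  (∀ g : GG p 3, f g ≠ 0 → ∃ (n : ℤ) (m : MM p 3) (u : GG p 3), u ∈ I1set p 3 ∧
      g = piSc p 3 n * iotaM p 3 m * x * u) ∧
  f x = v₀

/-- The conditions on the pair `(x, g)` under which `T_g` maps the standard function at `x`
to the standard function at `x g`: the double coset `K x I_1 g I_1` is `K x g I_1`, and only the
trivial coset contributes to the value at `x g`. -/
def IsAdditive (x g : GG p 3) : Prop :=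
  (∀ u ∈ I1set p 3, ∃ (m : MM p 3) (u' : GG p 3), u' ∈ I1set p 3 ∧
    x * u * g = iotaM p 3 m * x * g * u') ∧
  ∀ r ∈ I1set p 3, (∃ (n : ℤ) (m : MM p 3) (u : GG p 3), u ∈ I1set p 3 ∧
    x * (g * r * g⁻¹) = piSc p 3 n * iotaM p 3 m * x * u) → g * r * g⁻¹ ∈ I1set p 3

lemma IsAdditive.mul {x g h : GG p 3} (h₁ : IsAdditive x g) (h₂ : IsAdditive (x * g) h) :
    IsAdditive x (g * h) := by
  refine ⟨fun u hu => ?_, ?_⟩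
  · obtain ⟨m, u', hu', e⟩ := h₁.1 u hu
    obtain ⟨m', u'', hu'', e'⟩ := h₂.1 u' hu'
    refine ⟨m * m', u'', hu'', ?_⟩
    calc x * u * (g * h) = x * u * g * h := by group
      _ = iotaM p 3 m * (x * g * u' * h) := by rw [e]; group
      _ = _ := by rw [e', map_mul]; group
  · rintro r hr ⟨n, m, u, hu, e⟩
    have hs : h * r * h⁻¹ ∈ I1set p 3 := by
      apply h₂.2 r hr
      obtain ⟨m', u', hu', e'⟩ := h₁.1 u hu
      refine ⟨n, m * m', u', hu', ?_⟩
      calc x * g * (h * r * h⁻¹) = x * (g * h * r * (g * h)⁻¹) * g := by group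
        _ = piSc p 3 n * iotaM p 3 m * (x * u * g) := by rw [e]; group
        _ = _ := by rw [e', map_mul]; group
    have e2 : g * h * r * (g * h)⁻¹ = g * (h * r * h⁻¹) * g⁻¹ := by group
    rw [e2] at e ⊢
    exact h₁.2 _ hs ⟨n, m, u, hu, e⟩

variable {ρ : Representation (kb p) (Gk p 3) V} {v₀ : V}

lemma IsStdAt.unique {x : GG p 3} {f f' : GG p 3 → V} (hf : IsStdAt ρ v₀ x f)
    (hf' : IsStdAt ρ v₀ x f') : f = f' := by
  have key : ∀ {f : GG p 3 → V}, IsStdAt ρ v₀ x f → ∀ (n : ℤ) (m : MM p 3) (u : GG p 3),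
      u ∈ I1set p 3 → f (piSc p 3 n * iotaM p 3 m * x * u) = ρ (redM p 3 m) v₀ := by
    intro f hf n m u hu
    rw [hf.2.1 u hu, hf.1, hf.2.2.2]
  funext g
  by_cases h : f g = 0
  · by_cases h' : f' g = 0
    · rw [h, h']
    · obtain ⟨n, m, u, hu, rfl⟩ := hf'.2.2.1 g h'
      rw [key hf n m u hu, key hf' n m u hu]
  · obtain ⟨n, m, u, hu, rfl⟩ := hf.2.2.1 g h
    rw [key hf n m u hu, key hf' n m u hu]

lemma isI1Inv_hk {W : Type} [AddCommGroup W] {g : GG p 3} {R : Finset (GG p 3)} {f : GG p 3 → W}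
    (hR : IsRepSet p 3 g R)
    (hf : IsI1Inv p 3 f) : IsI1Inv p 3 (hk p 3 g R f) := by
  intro u hu y
  have hex : ∀ v ∈ I1set p 3, ∀ r ∈ R, ∃ r' ∈ R, r'⁻¹ * (v * r) ∈ I1set p 3 ∧
      g * (r'⁻¹ * (v * r)) * g⁻¹ ∈ I1set p 3 := fun v hv r hr =>
    let ⟨r', ⟨h1, h2⟩, _⟩ := hR.2 (v * r) (mul_mem_I1set hv (hR.1 hr))
    ⟨r', h1, h2⟩
  have huniq : ∀ x ∈ I1set p 3, ∀ r ∈ R, ∀ s ∈ R,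
      r⁻¹ * x ∈ I1set p 3 ∧ g * (r⁻¹ * x) * g⁻¹ ∈ I1set p 3 →
      s⁻¹ * x ∈ I1set p 3 ∧ g * (s⁻¹ * x) * g⁻¹ ∈ I1set p 3 → r = s :=
    fun x hx r hr s hs h1 h2 => (hR.2 x hx).unique ⟨hr, h1⟩ ⟨hs, h2⟩
  choose! i hi hi' using hex u hu
  refine Finset.sum_bij (fun r _ => i r) (fun r hr => hi r hr) ?_ ?_ ?_
  · intro r hr s hs e
    have h1 := hi' r hr
    have h2 := hi' s hs
    have e : i r = i s := e
    rw [← e] at h2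
    refine huniq r (hR.1 hr) r hr s hs ?_ ?_
    · simpa using one_mem_I1set
    · have e1 : s⁻¹ * r = ((i r)⁻¹ * (u * s))⁻¹ * ((i r)⁻¹ * (u * r)) := by group
      have e2 : g * (s⁻¹ * r) * g⁻¹ =
          (g * ((i r)⁻¹ * (u * s)) * g⁻¹)⁻¹ * (g * ((i r)⁻¹ * (u * r)) * g⁻¹) := by group
      rw [e2, e1]
      exact ⟨mul_mem_I1set (inv_mem_I1set h2.1) h1.1, mul_mem_I1set (inv_mem_I1set h2.2) h1.2⟩
  · intro s hs
    obtain ⟨r, hr, h⟩ := hex u⁻¹ (inv_mem_I1set hu) s hs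
    refine ⟨r, hr, ?_⟩
    have h1 := hi' r hr
    refine huniq (u * r) (mul_mem_I1set hu (hR.1 hr)) _ (hi r hr) s hs h1 ?_
    have e1 : s⁻¹ * (u * r) = (r⁻¹ * (u⁻¹ * s))⁻¹ := by group
    have e2 : g * (s⁻¹ * (u * r)) * g⁻¹ = (g * (r⁻¹ * (u⁻¹ * s)) * g⁻¹)⁻¹ := by group
    rw [e2, e1]
    exact ⟨inv_mem_I1set h.1, inv_mem_I1set h.2⟩
  · intro r hr
    have e : y * u * r * g⁻¹ = y * i r * g⁻¹ * (g * ((i r)⁻¹ * (u * r)) * g⁻¹) := by group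
    rw [e, hf _ (hi' r hr).2]

lemma IsStdAt.hk {x g : GG p 3} {R : Finset (GG p 3)} {f : GG p 3 → V}
    (hf : IsStdAt ρ v₀ x f) (hg : IsAdditive x g) (hR : IsRepSet p 3 g R) :
    IsStdAt ρ v₀ (x * g) (hk p 3 g R f) := by
  refine ⟨fun n m y => ?_, isI1Inv_hk hR hf.2.1, fun y hy => ?_, ?_⟩
  · unfold IH.hk
    rw [map_sum]
    refine Finset.sum_congr rfl fun r _ => ?_
    rw [← hf.1 n m]
    group
  · obtain ⟨r, hr, h⟩ := Finset.exists_ne_zero_of_sum_ne_zero hy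
    obtain ⟨n, m, u, hu, e⟩ := hf.2.2.1 _ h
    obtain ⟨m', u', hu', e'⟩ := hg.1 u hu
    refine ⟨n, m * m', u' * r⁻¹, mul_mem_I1set hu' (inv_mem_I1set (hR.1 hr)), ?_⟩
    calc y = y * r * g⁻¹ * g * r⁻¹ := by group
      _ = piSc p 3 n * iotaM p 3 m * (x * u * g) * r⁻¹ := by rw [e]; group
      _ = _ := by rw [e', map_mul]; group
  · obtain ⟨r₀, ⟨hr₀, h1, h2⟩, huniq⟩ := hR.2 1 one_mem_I1set
    have h3 : g * r₀ * g⁻¹ ∈ I1set p 3 := by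
      have e : g * r₀ * g⁻¹ = (g * (r₀⁻¹ * 1) * g⁻¹)⁻¹ := by group
      rw [e]
      exact inv_mem_I1set h2
    unfold IH.hk
    rw [Finset.sum_eq_single_of_mem r₀ hr₀]
    · have e : x * g * r₀ * g⁻¹ = x * (g * r₀ * g⁻¹) := by group
      rw [e, hf.2.1 _ h3, hf.2.2.2]
    · intro r hr hne
      by_contra h
      obtain ⟨n, m, u, hu, e⟩ := hf.2.2.1 _ h
      have e1 : x * g * r * g⁻¹ = x * (g * r * g⁻¹) := by group
      rw [e1] at e
      have h4 := hg.2 r (hR.1 hr) ⟨n, m, u, hu, e⟩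
      refine hne (huniq r ⟨hr, ?_, ?_⟩)
      · simpa using inv_mem_I1set (hR.1 hr)
      · have e2 : g * (r⁻¹ * 1) * g⁻¹ = (g * r * g⁻¹)⁻¹ := by group
        rw [e2]
        exact inv_mem_I1set h4

end Hecke

section Entries

variable {p}

lemma natCast_p_ne_zero : (p : ℚ_[p]) ≠ 0 := by
  exact_mod_cast (Fact.out : p.Prime).ne_zero

lemma mem_of_inv_mul_mem {x : ℚ_[p]} (h : (p : ℚ_[p])⁻¹ * x ∈ PadicInt.subring p) :
    x ∈ PadicInt.subring p := by
  have := mul_mem (natCast_mem (PadicInt.subring p) p) h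
  rwa [mul_inv_cancel_left₀ natCast_p_ne_zero] at this

lemma zpow_mem_subring {n : ℤ} (hn : 0 ≤ n) : (p : ℚ_[p]) ^ n ∈ PadicInt.subring p := by
  lift n to ℕ using hn
  rw [zpow_natCast]
  exact pow_mem (natCast_mem _ p) n

lemma inv_mem_subring_of_one_mod {x : ℚ_[p]} (h : (p : ℚ_[p])⁻¹ * (x - 1) ∈ PadicInt.subring p) :
    x ≠ 0 ∧ x⁻¹ ∈ PadicInt.subring p := by
  have hx : x ∈ PadicInt.subring p := by
    have := add_mem (mem_of_inv_mul_mem h) (one_mem (PadicInt.subring p))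
    rwa [sub_add_cancel] at this
  have h1 : PadicInt.toZMod (⟨x, hx⟩ : ℤ_[p]) = 1 := (toZMod_eq_one_iff _).2 h
  have h2 : ‖x‖ = 1 := PadicInt.isUnit_iff.1 (isUnit_of_toZMod_eq_one h1)
  refine ⟨fun h0 => by simp [h0] at h2, ?_⟩
  change ‖x⁻¹‖ ≤ 1
  rw [norm_inv, h2, inv_one]

lemma IsProPIwahori.of_entries {M : Matrix (Fin 3) (Fin 3) ℚ_[p]}
    (h01 : M 0 1 ∈ PadicInt.subring p) (h02 : M 0 2 ∈ PadicInt.subring p)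
    (h12 : M 1 2 ∈ PadicInt.subring p)
    (h10 : (p : ℚ_[p])⁻¹ * M 1 0 ∈ PadicInt.subring p)
    (h20 : (p : ℚ_[p])⁻¹ * M 2 0 ∈ PadicInt.subring p)
    (h21 : (p : ℚ_[p])⁻¹ * M 2 1 ∈ PadicInt.subring p)
    (hd : ∀ i, (p : ℚ_[p])⁻¹ * (M i i - 1) ∈ PadicInt.subring p) : IsProPIwahori M := by
  have hd' : ∀ i, M i i ∈ PadicInt.subring p := fun i => by
    have := add_mem (mem_of_inv_mul_mem (hd i)) (one_mem (PadicInt.subring p))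
    rwa [sub_add_cancel] at this
  refine ⟨fun i j => ?_, fun i j hij => ?_, hd⟩
  · fin_cases i <;> fin_cases j <;>
      first
      | exact hd' _
      | assumption
      | (apply mem_of_inv_mul_mem; assumption)
  · fin_cases i <;> fin_cases j <;> first | assumption | exact absurd hij (by decide)

/-- The elementary matrix `1 + c E_{ij}`. -/
def elemGL {R : Type*} [CommRing R] (i j : Fin 3) (h : i ≠ j) (c : R) : GL (Fin 3) R where
  val := Matrix.transvection i j c
  inv := Matrix.transvection i j (-c)
  val_inv := by rw [Matrix.transvection_mul_transvection_same i j h, add_neg_cancel,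
    Matrix.transvection_zero]
  inv_val := by rw [Matrix.transvection_mul_transvection_same i j h, neg_add_cancel,
    Matrix.transvection_zero]

lemma iotaM_elemGL (i j : Fin 3) (h : i ≠ j) (c : ℤ_[p]) :
    iotaM p 3 (elemGL i j h c) = elemGL i j h (c : ℚ_[p]) := by
  apply Units.ext
  ext k l
  rw [iotaM_apply]
  simp only [elemGL, Matrix.transvection, Matrix.add_apply, PadicInt.coe_add, Matrix.one_apply,
    Matrix.single_apply]
  split_ifs <;> simp

lemma coe_tGL (a : Fin 2 → ℤ) : (tGL p 3 a : Matrix (Fin 3) (Fin 3) ℚ_[p]) =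
    !![(p : ℚ_[p]) ^ a 0, 0, 0; 0, (p : ℚ_[p]) ^ a 1, 0; 0, 0, 1] := by
  ext i j
  fin_cases i <;> fin_cases j <;> simp [tGL, diagGL, expo, pU]

lemma coe_permGL_swap : (permGL p 3 (Equiv.swap 0 1) : Matrix (Fin 3) (Fin 3) ℚ_[p]) =
    !![0, 1, 0; 1, 0, 0; 0, 0, 1] := by
  ext i j
  fin_cases i <;> fin_cases j <;>
    simp [permGL, Equiv.Perm.permMatrix, PEquiv.toMatrix_apply, Equiv.swap_apply_def]

lemma permGL_one : permGL p 3 1 = 1 := by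
  apply Units.ext
  ext i j
  simp [permGL]

lemma wS_one (a : Fin 2 → ℤ) : wS p 3 1 a = tGL p 3 a := by
  rw [wS, permGL_one, one_mul]

lemma coe_wS_swap (a : Fin 2 → ℤ) :
    (wS p 3 (Equiv.swap 0 1) a : Matrix (Fin 3) (Fin 3) ℚ_[p]) =
    !![0, (p : ℚ_[p]) ^ a 1, 0; (p : ℚ_[p]) ^ a 0, 0, 0; 0, 0, 1] := by
  rw [wS, Units.val_mul, coe_permGL_swap, coe_tGL]
  ext i j
  fin_cases i <;> fin_cases j <;> simp [Matrix.mul_apply, Fin.sum_univ_three]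

lemma permGL_swap_mul_self :
    permGL p 3 (Equiv.swap 0 1) * permGL p 3 (Equiv.swap 0 1) = 1 := by
  apply Units.ext
  rw [Units.val_mul, coe_permGL_swap]
  ext i j
  fin_cases i <;> fin_cases j <;> simp [Matrix.mul_apply, Fin.sum_univ_three]

lemma permGL_swap_mul_tGL (a : Fin 2 → ℤ) :
    permGL p 3 (Equiv.swap 0 1) * tGL p 3 a =
      tGL p 3 ![a 1, a 0] * permGL p 3 (Equiv.swap 0 1) := by
  apply Units.ext
  rw [Units.val_mul, Units.val_mul, coe_permGL_swap, coe_tGL, coe_tGL]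
  ext i j
  fin_cases i <;> fin_cases j <;> simp [Matrix.mul_apply, Fin.sum_univ_three]

lemma tGL_mul_tGL (a b : Fin 2 → ℤ) : tGL p 3 a * tGL p 3 b = tGL p 3 ![a 0 + b 0, a 1 + b 1] := by
  have hp : (p : ℚ_[p]) ≠ 0 := natCast_p_ne_zero
  apply Units.ext
  rw [Units.val_mul, coe_tGL, coe_tGL, coe_tGL]
  ext i j
  fin_cases i <;> fin_cases j <;> simp [Matrix.mul_apply, Fin.sum_univ_three, zpow_add₀ hp]

lemma permGL_swap_mem_range : permGL p 3 (Equiv.swap 0 1) ∈ Set.range (iotaM p 3) := by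
  have h : (!![0, 1, 0; 1, 0, 0; 0, 0, 1] : Matrix (Fin 3) (Fin 3) ℤ_[p]) *
      !![0, 1, 0; 1, 0, 0; 0, 0, 1] = 1 := by
    ext i j
    fin_cases i <;> fin_cases j <;> simp [Matrix.mul_apply, Fin.sum_univ_three]
  refine ⟨⟨_, _, h, h⟩, ?_⟩
  apply Units.ext
  rw [coe_permGL_swap]
  ext i j
  rw [iotaM_apply]
  fin_cases i <;> fin_cases j <;> simp

lemma piSc_mul_comm (n : ℤ) (g : GG p 3) : piSc p 3 n * g = g * piSc p 3 n :=
  Units.ext (Algebra.commutes _ _)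

lemma norm_det_iotaM (m : MM p 3) : ‖(iotaM p 3 m : Matrix (Fin 3) (Fin 3) ℚ_[p]).det‖ = 1 := by
  have h : (iotaM p 3 m : Matrix (Fin 3) (Fin 3) ℚ_[p]).det =
      ((m : Matrix (Fin 3) (Fin 3) ℤ_[p]).det : ℚ_[p]) :=
    ((PadicInt.Coe.ringHom (p := p)).map_det _).symm
  rw [h]
  exact PadicInt.isUnit_iff.1 ((Matrix.isUnit_iff_isUnit_det _).1 m.isUnit)

lemma eq_zero_of_conj_eq {x g r u : GG p 3} (hr : r ∈ I1set p 3) (hu : u ∈ I1set p 3) {n : ℤ}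
    {m : MM p 3} (e : x * (g * r * g⁻¹) = piSc p 3 n * iotaM p 3 m * x * u) : n = 0 := by
  obtain ⟨r, -, rfl⟩ := hr
  obtain ⟨u, -, rfl⟩ := hu
  have hdet : ∀ y : GG p 3, ‖(y : Matrix (Fin 3) (Fin 3) ℚ_[p]).det‖ ≠ 0 := fun y => by
    rw [norm_ne_zero_iff]
    exact ((Matrix.isUnit_iff_isUnit_det _).1 y.isUnit).ne_zero
  have e' : x * g * iotaM p 3 r = piSc p 3 n * iotaM p 3 m * x * iotaM p 3 u * g := by
    rw [← e]
    group
  have h := congrArg (fun y : GG p 3 => ‖(y : Matrix (Fin 3) (Fin 3) ℚ_[p]).det‖) e'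
  simp only [Units.val_mul, Matrix.det_mul, norm_mul, norm_det_iotaM, mul_one] at h
  have hpi : ‖(piSc p 3 n : Matrix (Fin 3) (Fin 3) ℚ_[p]).det‖ = 1 := by
    have h2 : (1 : ℝ) * (‖(x : Matrix (Fin 3) (Fin 3) ℚ_[p]).det‖ *
      ‖(g : Matrix (Fin 3) (Fin 3) ℚ_[p]).det‖) = ‖(piSc p 3 n : Matrix (Fin 3) (Fin 3) ℚ_[p]).det‖ *
      (‖(x : Matrix (Fin 3) (Fin 3) ℚ_[p]).det‖ *
      ‖(g : Matrix (Fin 3) (Fin 3) ℚ_[p]).det‖) :=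
      (one_mul _).trans (h.trans (mul_assoc _ _ _))
    exact (mul_right_cancel₀ (mul_ne_zero (hdet x) (hdet g)) h2).symm
  have hc : (piSc p 3 n : Matrix (Fin 3) (Fin 3) ℚ_[p]) =
      Matrix.scalar (Fin 3) ((p : ℚ_[p]) ^ n) := by
    change algebraMap ℚ_[p] _ ((pU p ^ n : ℚ_[p]ˣ) : ℚ_[p]) = _
    rw [Units.val_zpow_eq_zpow_val]
    rfl
  rw [hc, Matrix.scalar_apply, Matrix.det_diagonal] at hpi
  simp only [Finset.prod_const, Finset.card_univ, Fintype.card_fin, norm_pow,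
    Padic.norm_p_zpow] at hpi
  have hp1 : (1 : ℝ) < p := by exact_mod_cast (Fact.out : p.Prime).one_lt
  rw [← zpow_natCast, ← _root_.zpow_mul, zpow_eq_one_iff_right₀ (by linarith) hp1.ne'] at hpi
  push_cast at hpi
  lia

lemma IsAdditive.iotaM_mul {x g : GG p 3} (h : IsAdditive x g) {k : GG p 3}
    (hk : k ∈ Set.range (iotaM p 3)) : IsAdditive (k * x) g := by
  obtain ⟨k, rfl⟩ := hk
  refine ⟨fun u hu => ?_, ?_⟩
  · obtain ⟨m, u', hu', e⟩ := h.1 u hu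
    refine ⟨k * m * k⁻¹, u', hu', ?_⟩
    calc iotaM p 3 k * x * u * g = iotaM p 3 k * (x * u * g) := by group
      _ = _ := by rw [e, map_mul, map_mul, map_inv]; group
  · rintro r hr ⟨n, m, u, hu, e⟩
    refine h.2 r hr ⟨n, k⁻¹ * m * k, u, hu, ?_⟩
    calc x * (g * r * g⁻¹) = (iotaM p 3 k)⁻¹ * (iotaM p 3 k * x * (g * r * g⁻¹)) := by group
      _ = (iotaM p 3 k)⁻¹ * piSc p 3 n * (iotaM p 3 m * (iotaM p 3 k * x) * u) := by rw [e]; group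
      _ = _ := by rw [← piSc_mul_comm, map_mul, map_mul, map_inv]; group

end Entries

section Additive

variable {p}

/-- Conjugation by a matrix of the form `ω₁ t_{(0,-1)}`, in terms of entries. -/
lemma wS_swap_conj_entries {s r : GG p 3}
    (h : s * wS p 3 (Equiv.swap 0 1) ![0, -1] = wS p 3 (Equiv.swap 0 1) ![0, -1] * r) :
    s 0 0 = r 1 1 ∧ s 0 1 = (p : ℚ_[p])⁻¹ * r 1 0 ∧ s 0 2 = (p : ℚ_[p])⁻¹ * r 1 2 ∧
    s 1 0 = p * r 0 1 ∧ s 1 1 = r 0 0 ∧ s 1 2 = r 0 2 ∧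
    s 2 0 = p * r 2 1 ∧ s 2 1 = r 2 0 ∧ s 2 2 = r 2 2 := by
  have hp : (p : ℚ_[p]) ≠ 0 := natCast_p_ne_zero
  have h' : ∀ i j, (s * wS p 3 (Equiv.swap 0 1) ![0, -1] : GG p 3) i j =
      (wS p 3 (Equiv.swap 0 1) ![0, -1] * r : GG p 3) i j := fun i j => by rw [h]
  simp only [Units.val_mul, coe_wS_swap, Matrix.mul_apply, Fin.sum_univ_three] at h'
  have h00 := h' 0 0
  have h01 := h' 0 1
  have h02 := h' 0 2
  have h10 := h' 1 0
  have h11 := h' 1 1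
  have h12 := h' 1 2
  have h20 := h' 2 0
  have h21 := h' 2 1
  have h22 := h' 2 2
  simp at h00 h01 h02 h10 h11 h12 h20 h21 h22
  refine ⟨mul_right_cancel₀ (inv_ne_zero hp) (h01.trans (mul_comm _ _)), h00, h02, ?_, h10, h12,
    ?_, h20, h22⟩
  · rw [← h11]
    field_simp
  · rw [← h21]
    field_simp

lemma permGL_swap_conj_entries {s r : GG p 3}
    (h : s * permGL p 3 (Equiv.swap 0 1) = permGL p 3 (Equiv.swap 0 1) * r) :
    s 0 0 = r 1 1 ∧ s 0 1 = r 1 0 ∧ s 0 2 = r 1 2 ∧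
    s 1 0 = r 0 1 ∧ s 1 1 = r 0 0 ∧ s 1 2 = r 0 2 ∧
    s 2 0 = r 2 1 ∧ s 2 1 = r 2 0 ∧ s 2 2 = r 2 2 := by
  have h' : ∀ i j, (s * permGL p 3 (Equiv.swap 0 1) : GG p 3) i j =
      (permGL p 3 (Equiv.swap 0 1) * r : GG p 3) i j := fun i j => by rw [h]
  simp only [Units.val_mul, coe_permGL_swap, Matrix.mul_apply, Fin.sum_univ_three] at h'
  have h00 := h' 0 0
  have h01 := h' 0 1
  have h02 := h' 0 2
  have h10 := h' 1 0
  have h11 := h' 1 1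
  have h12 := h' 1 2
  have h20 := h' 2 0
  have h21 := h' 2 1
  have h22 := h' 2 2
  simp at h00 h01 h02 h10 h11 h12 h20 h21 h22
  simp only [*, and_self]

/-- The first condition of `IsAdditive`, given a decomposition `u = l w` with `x l x⁻¹ ∈ K`
and `g⁻¹ w g ∈ I_1`. -/
lemma exists_mul_eq_of_conj {x g u l : GG p 3} {m : MM p 3} (hl : x * l = iotaM p 3 m * x)
    (hw : g⁻¹ * (l⁻¹ * u) * g ∈ I1set p 3) :
    ∃ (m : MM p 3) (u' : GG p 3), u' ∈ I1set p 3 ∧ x * u * g = iotaM p 3 m * x * g * u' := by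
  refine ⟨m, _, hw, ?_⟩
  rw [← hl]
  group

lemma exists_tGL_mul_elemGL (a : Fin 2 → ℤ) (i j : Fin 3) (h : i ≠ j) {c : ℚ_[p]}
    (hc : (p : ℚ_[p]) ^ (expo 3 a i - expo 3 a j) * c ∈ PadicInt.subring p) :
    ∃ m : MM p 3, tGL p 3 a * elemGL i j h c = iotaM p 3 m * tGL p 3 a := by
  have hp : (p : ℚ_[p]) ≠ 0 := natCast_p_ne_zero
  obtain ⟨d, hd⟩ : ∃ d : ℤ_[p], (d : ℚ_[p]) = (p : ℚ_[p]) ^ (expo 3 a i - expo 3 a j) * c :=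
    ⟨⟨_, hc⟩, rfl⟩
  refine ⟨elemGL i j h d, ?_⟩
  rw [iotaM_elemGL, hd]
  apply Units.ext
  ext k l
  simp only [tGL, diagGL, elemGL, Matrix.transvection, Units.val_mul, Matrix.add_apply,
    Matrix.diagonal_mul, Matrix.mul_diagonal, mul_add, add_mul, Matrix.one_apply,
    Matrix.single_apply]
  congr 1
  · split_ifs with hk
    · rw [hk, mul_comm]
    · simp
  · split_ifs with hk
    · obtain ⟨rfl, rfl⟩ := hk
      simp only [pU, Units.val_zpow_eq_zpow_val, Units.val_mk0, zpow_sub₀ hp]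
      field_simp
    · simp

/-- Entries of `s v` when `t_a s = k t_a v⁻¹` with `k ∈ K`. -/
lemma mul_entry_mem {a : Fin 2 → ℤ} {s v : GG p 3} {m : MM p 3}
    (e : tGL p 3 a * s = iotaM p 3 m * tGL p 3 a * v⁻¹) (i j : Fin 3) :
    ∃ c ∈ PadicInt.subring p, (s * v : GG p 3) i j = (p : ℚ_[p]) ^ (expo 3 a j - expo 3 a i) * c := by
  have hp : (p : ℚ_[p]) ≠ 0 := natCast_p_ne_zero
  have e' : tGL p 3 a * (s * v) = iotaM p 3 m * tGL p 3 a := by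
    rw [← mul_assoc, e]
    group
  refine ⟨_, (m i j : ℤ_[p]).2, ?_⟩
  have h := congrArg (fun y : GG p 3 => (y : Matrix (Fin 3) (Fin 3) ℚ_[p]) i j) e'
  simp only [tGL, diagGL, Units.val_mul, Matrix.diagonal_mul, Matrix.mul_diagonal,
    iotaM_apply] at h
  simp only [pU, Units.val_zpow_eq_zpow_val, Units.val_mk0] at h
  rw [zpow_sub₀ hp, Units.val_mul]
  have h0 : (p : ℚ_[p]) ^ expo 3 a i ≠ 0 := zpow_ne_zero _ hp
  rw [div_mul_eq_mul_div, eq_div_iff h0, mul_comm _ ((p : ℚ_[p]) ^ expo 3 a i)]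
  rw [Matrix.mul_apply] at h
  rw [Matrix.mul_apply, h, mul_comm]

lemma coe_inv_elemGL_mul (i j : Fin 3) (h : i ≠ j) (c : ℚ_[p]) (u : GG p 3) (k l : Fin 3) :
    ((elemGL i j h c)⁻¹ * u : GG p 3) k l = u k l - if k = i then c * u j l else 0 := by
  have e : ((elemGL i j h c)⁻¹ : GG p 3) = (elemGL i j h (-c) : GG p 3) := by
    apply inv_eq_of_mul_eq_one_right
    apply Units.ext
    exact (elemGL i j h c).val_inv
  rw [e]
  by_cases hk : k = i
  · subst hk
    simp [elemGL, Matrix.transvection_mul_apply_same, sub_eq_add_neg]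
  · simp [elemGL, hk]

lemma isAdditive_tGL_wS {a : Fin 2 → ℤ} (ha : a 0 ≤ 0) :
    IsAdditive (tGL p 3 a) (wS p 3 (Equiv.swap 0 1) ![0, -1]) := by
  have hp : (p : ℚ_[p]) ≠ 0 := natCast_p_ne_zero
  constructor
  · intro u hu
    obtain ⟨hO, hlow, hdiag⟩ := (mem_I1set_iff u).1 hu
    obtain ⟨hne, hinv⟩ := inv_mem_subring_of_one_mod (hdiag 0)
    have hy : (p : ℚ_[p])⁻¹ * (u 2 0 * (u 0 0)⁻¹) ∈ PadicInt.subring p := by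
      rw [← mul_assoc]
      exact mul_mem (hlow 2 0 (by decide)) hinv
    obtain ⟨m, hm⟩ := exists_tGL_mul_elemGL a 2 0 (by decide) (c := u 2 0 * (u 0 0)⁻¹) (by
      apply mul_mem (zpow_mem_subring _) (mem_of_inv_mul_mem hy)
      simpa [expo] using ha)
    refine exists_mul_eq_of_conj hm ?_
    set y := u 2 0 * (u 0 0)⁻¹
    have hyu : y * u 0 0 = u 2 0 := inv_mul_cancel_right₀ hne _
    have hw := coe_inv_elemGL_mul 2 0 (by decide) y u
    generalize (elemGL 2 0 (by decide) y)⁻¹ * u = w at hw ⊢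
    set g := wS p 3 (Equiv.swap 0 1) ![0, -1]
    have hg : w * g = g * (g⁻¹ * w * g) := by group
    generalize g⁻¹ * w * g = r at hg ⊢
    obtain ⟨e00, e01, e02, e10, e11, e12, e20, e21, e22⟩ := wS_swap_conj_entries hg
    simp only [hw, Fin.reduceEq, if_true, if_false, sub_zero, hyu, sub_self] at *
    have e10' : r 1 0 = p * u 0 1 := by rw [e01, mul_inv_cancel_left₀ hp]
    have e12' : r 1 2 = p * u 0 2 := by rw [e02, mul_inv_cancel_left₀ hp]
    have e01' : r 0 1 = (p : ℚ_[p])⁻¹ * u 1 0 := by rw [e10, inv_mul_cancel_left₀ hp]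
    have e21' : r 2 1 = 0 := by simpa [hp] using e20.symm
    rw [mem_I1set_iff]
    apply IsProPIwahori.of_entries
    · rw [e01']
      exact hlow 1 0 (by decide)
    · rw [← e12]
      exact hO _ _
    · rw [e12']
      exact mul_mem (natCast_mem _ _) (hO _ _)
    · rw [e10', inv_mul_cancel_left₀ hp]
      exact hO _ _
    · rw [← e21, mul_sub, ← mul_assoc]
      exact sub_mem (hlow 2 1 (by decide)) (mul_mem hy (hO 0 1))
    · rw [e21', mul_zero]
      exact zero_mem _
    · intro i
      fin_cases i
      · exact e11 ▸ hdiag 1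
      · exact e00 ▸ hdiag 0
      · have h3 : (p : ℚ_[p])⁻¹ * (r 2 2 - 1) =
            (p : ℚ_[p])⁻¹ * (u 2 2 - 1) - (p : ℚ_[p])⁻¹ * y * u 0 2 := by
          rw [← e22]
          ring
        exact h3 ▸ sub_mem (hdiag 2) (mul_mem hy (hO 0 2))
  · rintro r hr ⟨n, m, u, hu, e⟩
    obtain rfl := eq_zero_of_conj_eq hr hu e
    have e' : tGL p 3 a * (wS p 3 (Equiv.swap 0 1) ![0, -1] * r *
        (wS p 3 (Equiv.swap 0 1) ![0, -1])⁻¹) = iotaM p 3 m * tGL p 3 a * (u⁻¹)⁻¹ := by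
      rw [e, inv_inv]
      simp [piSc, scalarGL]
    set g := wS p 3 (Equiv.swap 0 1) ![0, -1]
    have hg : (g * r * g⁻¹) * g = g * r := by group
    generalize g * r * g⁻¹ = s at hg e' ⊢
    obtain ⟨hO, hlow, hdiag⟩ := (mem_I1set_iff r).1 hr
    obtain ⟨vO, vlow, vdiag⟩ := (mem_I1set_iff _).1 (inv_mem_I1set hu)
    obtain ⟨c, hc, hsv⟩ := mul_entry_mem e' 0 2
    generalize u⁻¹ = v at hsv vO vlow vdiag
    obtain ⟨hne, hinv⟩ := inv_mem_subring_of_one_mod (vdiag 2)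
    obtain ⟨e00, e01, e02, e10, e11, e12, e20, e21, e22⟩ := wS_swap_conj_entries hg
    rw [Units.val_mul, Matrix.mul_apply, Fin.sum_univ_three] at hsv
    have h02 : s 0 2 = ((p : ℚ_[p]) ^ (expo 3 a 2 - expo 3 a 0) * c - s 0 0 * v 0 2 -
        s 0 1 * v 1 2) * (v 2 2)⁻¹ := by
      rw [← hsv]
      field_simp
      ring
    have m01 : s 0 1 ∈ PadicInt.subring p := e01 ▸ hlow 1 0 (by decide)
    rw [mem_I1set_iff]
    apply IsProPIwahori.of_entries
    · exact m01
    · rw [h02]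
      refine mul_mem (sub_mem (sub_mem (mul_mem (zpow_mem_subring ?_) hc)
        (mul_mem (e00 ▸ hO _ _) (vO _ _))) (mul_mem m01 (vO _ _))) hinv
      simpa [expo] using ha
    · exact e12 ▸ hO _ _
    · rw [e10, inv_mul_cancel_left₀ hp]
      exact hO _ _
    · rw [e20, inv_mul_cancel_left₀ hp]
      exact hO _ _
    · exact e21 ▸ hlow 2 0 (by decide)
    · intro i
      fin_cases i
      · exact e00 ▸ hdiag 1
      · exact e11 ▸ hdiag 0
      · exact e22 ▸ hdiag 2

lemma isAdditive_tGL_permGL {a : Fin 2 → ℤ} (ha : a 1 < a 0) :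
    IsAdditive (tGL p 3 a) (permGL p 3 (Equiv.swap 0 1)) := by
  have hp : (p : ℚ_[p]) ≠ 0 := natCast_p_ne_zero
  constructor
  · intro u hu
    obtain ⟨hO, hlow, hdiag⟩ := (mem_I1set_iff u).1 hu
    obtain ⟨hne, hinv⟩ := inv_mem_subring_of_one_mod (hdiag 1)
    have hy : u 0 1 * (u 1 1)⁻¹ ∈ PadicInt.subring p := mul_mem (hO _ _) hinv
    obtain ⟨m, hm⟩ := exists_tGL_mul_elemGL a 0 1 (by decide) (c := u 0 1 * (u 1 1)⁻¹) (by
      apply mul_mem (zpow_mem_subring _) hy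
      simpa [expo] using ha.le)
    refine exists_mul_eq_of_conj hm ?_
    set y := u 0 1 * (u 1 1)⁻¹
    have hyu : y * u 1 1 = u 0 1 := inv_mul_cancel_right₀ hne _
    have hw := coe_inv_elemGL_mul 0 1 (by decide) y u
    generalize (elemGL 0 1 (by decide) y)⁻¹ * u = w at hw ⊢
    set g := permGL p 3 (Equiv.swap 0 1)
    have hg : w * g = g * (g⁻¹ * w * g) := by group
    generalize g⁻¹ * w * g = r at hg ⊢
    obtain ⟨e00, e01, e02, e10, e11, e12, e20, e21, e22⟩ := permGL_swap_conj_entries hg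
    simp only [hw, Fin.reduceEq, if_true, if_false, sub_zero, hyu, sub_self] at *
    rw [mem_I1set_iff]
    apply IsProPIwahori.of_entries
    · exact e10 ▸ hO _ _
    · exact e12 ▸ hO _ _
    · exact e02 ▸ sub_mem (hO _ _) (mul_mem hy (hO _ _))
    · rw [← e01, mul_zero]
      exact zero_mem _
    · exact e21 ▸ hlow 2 1 (by decide)
    · exact e20 ▸ hlow 2 0 (by decide)
    · intro i
      fin_cases i
      · exact e11 ▸ hdiag 1
      · have h3 : (p : ℚ_[p])⁻¹ * (r 1 1 - 1) =
            (p : ℚ_[p])⁻¹ * (u 0 0 - 1) - y * ((p : ℚ_[p])⁻¹ * u 1 0) := by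
          rw [← e00]
          ring
        exact h3 ▸ sub_mem (hdiag 0) (mul_mem hy (hlow 1 0 (by decide)))
      · exact e22 ▸ hdiag 2
  · rintro r hr ⟨n, m, u, hu, e⟩
    obtain rfl := eq_zero_of_conj_eq hr hu e
    have e' : tGL p 3 a * (permGL p 3 (Equiv.swap 0 1) * r *
        (permGL p 3 (Equiv.swap 0 1))⁻¹) = iotaM p 3 m * tGL p 3 a * (u⁻¹)⁻¹ := by
      rw [e, inv_inv]
      simp [piSc, scalarGL]
    set g := permGL p 3 (Equiv.swap 0 1)
    have hg : (g * r * g⁻¹) * g = g * r := by group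
    generalize g * r * g⁻¹ = s at hg e' ⊢
    obtain ⟨hO, hlow, hdiag⟩ := (mem_I1set_iff r).1 hr
    obtain ⟨vO, vlow, vdiag⟩ := (mem_I1set_iff _).1 (inv_mem_I1set hu)
    obtain ⟨c, hc, hsv⟩ := mul_entry_mem e' 1 0
    generalize u⁻¹ = v at hsv vO vlow vdiag
    obtain ⟨hne, hinv⟩ := inv_mem_subring_of_one_mod (vdiag 0)
    obtain ⟨e00, e01, e02, e10, e11, e12, e20, e21, e22⟩ := permGL_swap_conj_entries hg
    rw [Units.val_mul, Matrix.mul_apply, Fin.sum_univ_three] at hsv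
    have h10 : (p : ℚ_[p])⁻¹ * s 1 0 = ((p : ℚ_[p]) ^ (expo 3 a 0 - expo 3 a 1 - 1) * c -
        s 1 1 * ((p : ℚ_[p])⁻¹ * v 1 0) - s 1 2 * ((p : ℚ_[p])⁻¹ * v 2 0)) * (v 0 0)⁻¹ := by
      rw [zpow_sub_one₀ hp, mul_right_comm, ← hsv]
      field_simp
      ring
    rw [mem_I1set_iff]
    apply IsProPIwahori.of_entries
    · exact e01 ▸ mem_of_inv_mul_mem (hlow 1 0 (by decide))
    · exact e02 ▸ hO _ _
    · exact e12 ▸ hO _ _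
    · rw [h10]
      refine mul_mem (sub_mem (sub_mem (mul_mem (zpow_mem_subring ?_) hc)
        (mul_mem (e11 ▸ hO _ _) (vlow _ _ (by decide))))
        (mul_mem (e12 ▸ hO _ _) (vlow _ _ (by decide)))) hinv
      simp only [expo, Fin.isValue]
      simp
      lia
    · exact e20 ▸ hlow 2 1 (by decide)
    · exact e21 ▸ hlow 2 0 (by decide)
    · intro i
      fin_cases i
      · exact e00 ▸ hdiag 1
      · exact e11 ▸ hdiag 0
      · exact e22 ▸ hdiag 2

end Additive

section Membership

variable {p}

lemma not_mem_Sset {σ : Equiv.Perm (Fin 3)} {a : Fin 2 → ℤ} {i j k l : Fin 3} (hij : i ≠ j)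
    (hlk : l < k) {c : ℚ_[p]} (hc : elemGL i j hij c ∈ I1set p 3)
    (h : wS p 3 σ a * elemGL i j hij c = elemGL k l hlk.ne' 1 * wS p 3 σ a) : a ∉ Sset p 3 σ := by
  intro ha
  have hI : elemGL i j hij c ∈ Iset p 3 := Set.image_mono (fun _ hm => hm.1) hc
  have hconj : wS p 3 σ a * elemGL i j hij c * (wS p 3 σ a)⁻¹ =
      iotaM p 3 (elemGL k l hlk.ne' 1) := by
    rw [h, mul_inv_cancel_right, iotaM_elemGL, PadicInt.coe_one]
  obtain ⟨m, hm, e⟩ := ha _ hI (hconj ▸ ⟨_, rfl⟩)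
  have h0 := (toZMod_eq_zero_iff _).1 (hm k l hlk)
  have h1 : ((m : Matrix (Fin 3) (Fin 3) ℤ_[p]) k l : ℚ_[p]) = ((1 : ℤ_[p]) : ℚ_[p]) := by
    rw [← iotaM_apply, e, hconj, iotaM_apply]
    simp [elemGL, Matrix.transvection, Matrix.one_apply_ne hlk.ne']
  rw [h1, ← toZMod_eq_zero_iff, map_one] at h0
  exact one_ne_zero h0

lemma elemGL_mem_I1set {i j : Fin 3} (h : i ≠ j) {c : ℚ_[p]} (hc : c ∈ PadicInt.subring p)
    (hc' : j < i → (p : ℚ_[p])⁻¹ * c ∈ PadicInt.subring p) : elemGL i j h c ∈ I1set p 3 := by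
  rw [mem_I1set_iff]
  refine ⟨fun k l => ?_, fun k l hkl => ?_, fun k => ?_⟩
  · simp only [elemGL, Matrix.transvection, Matrix.add_apply, Matrix.one_apply,
      Matrix.single_apply]
    refine add_mem ?_ ?_
    · split_ifs
      exacts [one_mem _, zero_mem _]
    · split_ifs
      exacts [hc, zero_mem _]
  · simp only [elemGL, Matrix.transvection, Matrix.add_apply, Matrix.one_apply_ne hkl.ne',
      Matrix.single_apply, zero_add]
    split_ifs with hk
    · obtain ⟨rfl, rfl⟩ := hk
      exact hc' hkl
    · simp
  · have hk : ¬ (i = k ∧ j = k) := fun hk => h (hk.1.trans hk.2.symm)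
    simp [elemGL, Matrix.transvection, hk]

lemma elemGL_zpow_mem_I1set {i j : Fin 3} (h : i ≠ j) {n : ℤ} (hn : 0 < n) :
    elemGL i j h ((p : ℚ_[p]) ^ n) ∈ I1set p 3 := by
  refine elemGL_mem_I1set h (zpow_mem_subring hn.le) fun _ => ?_
  rw [mul_comm, ← zpow_sub_one₀ natCast_p_ne_zero]
  exact zpow_mem_subring (by lia)

lemma le_of_mem_Sset_one {a : Fin 2 → ℤ} (ha : a ∈ Sset p 3 1) : a 0 ≤ a 1 ∧ a 1 ≤ 0 := by
  have hp : (p : ℚ_[p]) ≠ 0 := natCast_p_ne_zero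
  constructor
  · by_contra! h
    refine not_mem_Sset (i := 1) (j := 0) (k := 1) (l := 0) (by decide) (by decide)
      (elemGL_zpow_mem_I1set (by decide) (n := a 0 - a 1) (by lia)) ?_ ha
    rw [wS_one]
    apply Units.ext
    rw [Units.val_mul, Units.val_mul, coe_tGL]
    ext i j
    fin_cases i <;> fin_cases j <;> simp [elemGL, Matrix.transvection, Matrix.mul_apply,
      Fin.sum_univ_three, zpow_sub₀ hp] <;> field_simp
  · by_contra! h
    refine not_mem_Sset (i := 2) (j := 1) (k := 2) (l := 1) (by decide) (by decide)
      (elemGL_zpow_mem_I1set (by decide) (n := a 1) h) ?_ ha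
    rw [wS_one]
    apply Units.ext
    rw [Units.val_mul, Units.val_mul, coe_tGL]
    ext i j
    fin_cases i <;> fin_cases j <;> simp [elemGL, Matrix.transvection, Matrix.mul_apply,
      Fin.sum_univ_three]

lemma lt_of_mem_Sset_swap {a : Fin 2 → ℤ} (ha : a ∈ Sset p 3 (Equiv.swap 0 1)) :
    a 1 < a 0 ∧ a 0 ≤ 0 := by
  have hp : (p : ℚ_[p]) ≠ 0 := natCast_p_ne_zero
  constructor
  · by_contra! h
    refine not_mem_Sset (i := 0) (j := 1) (k := 1) (l := 0) (by decide) (by decide)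
      (elemGL_mem_I1set (by decide) (c := (p : ℚ_[p]) ^ (a 1 - a 0))
        (zpow_mem_subring (by lia)) (fun hlt => absurd hlt (by decide))) ?_ ha
    apply Units.ext
    rw [Units.val_mul, Units.val_mul, coe_wS_swap]
    ext i j
    fin_cases i <;> fin_cases j <;> simp [elemGL, Matrix.transvection, Matrix.mul_apply,
      Fin.sum_univ_three, zpow_sub₀ hp] <;> field_simp
  · by_contra! h
    refine not_mem_Sset (i := 2) (j := 0) (k := 2) (l := 1) (by decide) (by decide)
      (elemGL_zpow_mem_I1set (by decide) (n := a 0) h) ?_ ha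
    apply Units.ext
    rw [Units.val_mul, Units.val_mul, coe_wS_swap]
    ext i j
    fin_cases i <;> fin_cases j <;> simp [elemGL, Matrix.transvection, Matrix.mul_apply,
      Fin.sum_univ_three]

variable {V : Type} [AddCommGroup V] [Module (kb p) V]
variable {ρ : Representation (kb p) (Gk p 3) V} {v₀ : V}

lemma IsStd.isStdAt {σ : Equiv.Perm (Fin 3)} (hσ : permGL p 3 σ ∈ Set.range (iotaM p 3))
    {a : Fin 2 → ℤ} {f : GG p 3 → V} (hf : IsStd p 3 ρ v₀ σ a f) :
    IsStdAt ρ v₀ (wS p 3 σ a) f := by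
  refine ⟨hf.1.1, hf.2.1, fun g hg => ?_, hf.2.2.2⟩
  obtain ⟨n, m, u, hu, rfl⟩ := hf.2.2.1 g hg
  obtain ⟨k, hk⟩ := hσ
  refine ⟨n, m * k⁻¹, u, hu, ?_⟩
  rw [wS, ← hk, map_mul, map_inv]
  group

lemma IsFsr.isStdAt_one {a : Fin 2 → ℤ} {f : GG p 3 → V} (hf : IsFsr p ρ v₀ a f)
    (ha : a 0 ≤ a 1) : IsStdAt ρ v₀ (tGL p 3 a) f := by
  rcases hf with ⟨-, hf⟩ | ⟨hS, -⟩
  · rw [← wS_one]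
    exact hf.isStdAt ⟨1, by rw [permGL_one, map_one]⟩
  · exact absurd (lt_of_mem_Sset_swap hS).1 (not_lt.2 ha)

lemma IsFsr.isStdAt_swap {a : Fin 2 → ℤ} {f : GG p 3 → V} (hf : IsFsr p ρ v₀ a f)
    (ha : a 1 < a 0) : IsStdAt ρ v₀ (wS p 3 (Equiv.swap 0 1) a) f := by
  rcases hf with ⟨hS, -⟩ | ⟨-, hf⟩
  · exact absurd (le_of_mem_Sset_one hS).1 (not_le.2 ha)
  · exact hf.isStdAt permGL_swap_mem_range

lemma tGL_mul_wS_swap (a b : Fin 2 → ℤ) : tGL p 3 a * wS p 3 (Equiv.swap 0 1) b =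
    wS p 3 (Equiv.swap 0 1) ![a 1 + b 0, a 0 + b 1] := by
  have h := permGL_swap_mul_tGL (p := p) ![a 1, a 0]
  have ha : ![(![a 1, a 0] : Fin 2 → ℤ) 1, (![a 1, a 0] : Fin 2 → ℤ) 0] = a := by
    ext i
    fin_cases i <;> rfl
  rw [ha] at h
  rw [wS, ← mul_assoc, ← h, mul_assoc, tGL_mul_tGL]
  rfl

lemma wS_swap_mul_wS_swap (a b : Fin 2 → ℤ) :
    wS p 3 (Equiv.swap 0 1) a * wS p 3 (Equiv.swap 0 1) b = tGL p 3 ![a 1 + b 0, a 0 + b 1] := by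
  rw [wS, mul_assoc, tGL_mul_wS_swap, wS, ← mul_assoc, permGL_swap_mul_self, one_mul]

lemma wS_swap_mul_permGL_swap (a : Fin 2 → ℤ) :
    wS p 3 (Equiv.swap 0 1) a * permGL p 3 (Equiv.swap 0 1) = tGL p 3 ![a 1, a 0] := by
  rw [wS, permGL_swap_mul_tGL, mul_assoc, permGL_swap_mul_self, mul_one]

lemma isAdditive_wS_wS {a : Fin 2 → ℤ} (ha : a 0 ≤ 0) :
    IsAdditive (wS p 3 (Equiv.swap 0 1) a) (wS p 3 (Equiv.swap 0 1) ![0, -1]) :=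
  (isAdditive_tGL_wS ha).iotaM_mul permGL_swap_mem_range

lemma isAdditive_wS_permGL {a : Fin 2 → ℤ} (ha : a 1 < a 0) :
    IsAdditive (wS p 3 (Equiv.swap 0 1) a) (permGL p 3 (Equiv.swap 0 1)) :=
  (isAdditive_tGL_permGL ha).iotaM_mul permGL_swap_mem_range

end Membership

/-- composite Hecke operators in the semi-regular case for `N = 3`. -/
theorem stmt16 (p : ℕ) [Fact p.Prime]
    {V : Type} [AddCommGroup V] [Module (kb p) V] [FiniteDimensional (kb p) V]
    (ρ : Representation (kb p) (Gk p 3) V) (hirr : IsIrred p 3 ρ)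
    (v₀ : V) (hv₀ : v₀ ≠ 0)
    (hfix : ∀ m ∈ I1pre p 3, ρ (redM p 3 m) v₀ = v₀)
    (η : (ZMod p)ˣ →* (kb p)ˣ) (hη : η ≠ 1)
    (hχ : ∀ m ∈ Ipre p 3, ρ (redM p 3 m) v₀ =
      (η (unitOf p ((redM p 3 m : Matrix (Fin 3) (Fin 3) (ZMod p)) 2 2)) : kb p) • v₀) :
    (∀ a : Fin 2 → ℤ, a ∈ Sset p 3 1 →
      ∀ f f₁ f₂ : GG p 3 → V, IsFsr p ρ v₀ a f →
        IsFsr p ρ v₀ ![a 0 - 1, a 1] f₁ → IsFsr p ρ v₀ ![a 0 - 1, a 1 - 1] f₂ →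
        ∀ R₀ Rω R₁ R₂ : Finset (GG p 3),
          IsRepSet p 3 (wS p 3 (Equiv.swap (0 : Fin 3) 1) ![0, -1]) R₀ → IsRepSet p 3 (permGL p 3 (Equiv.swap (0 : Fin 3) 1)) Rω →
          IsRepSet p 3 (tGL p 3 ![-1, 0]) R₁ → IsRepSet p 3 (tGL p 3 ![-1, -1]) R₂ →
          (hk p 3 (permGL p 3 (Equiv.swap (0 : Fin 3) 1)) Rω (hk p 3 (wS p 3 (Equiv.swap (0 : Fin 3) 1) ![0, -1]) R₀ f) = f₁ ∧
           hk p 3 (tGL p 3 ![-1, 0]) R₁ f = f₁ ∧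
           hk p 3 (wS p 3 (Equiv.swap (0 : Fin 3) 1) ![0, -1]) R₀ (hk p 3 (wS p 3 (Equiv.swap (0 : Fin 3) 1) ![0, -1]) R₀ f) = f₂ ∧
           hk p 3 (tGL p 3 ![-1, -1]) R₂ f = f₂)) ∧
    (∀ a : Fin 2 → ℤ, a ∈ Sset p 3 (Equiv.swap (0 : Fin 3) 1) →
      ∀ f f₁ f₂ : GG p 3 → V, IsFsr p ρ v₀ a f →
        IsFsr p ρ v₀ ![a 0, a 1 - 1] f₁ → IsFsr p ρ v₀ ![a 0 - 1, a 1 - 1] f₂ →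
        ∀ R₀ Rω R₁ R₂ : Finset (GG p 3),
          IsRepSet p 3 (wS p 3 (Equiv.swap (0 : Fin 3) 1) ![0, -1]) R₀ → IsRepSet p 3 (permGL p 3 (Equiv.swap (0 : Fin 3) 1)) Rω →
          IsRepSet p 3 (tGL p 3 ![0, -1]) R₁ → IsRepSet p 3 (tGL p 3 ![-1, -1]) R₂ →
          (hk p 3 (wS p 3 (Equiv.swap (0 : Fin 3) 1) ![0, -1]) R₀ (hk p 3 (permGL p 3 (Equiv.swap (0 : Fin 3) 1)) Rω f) = f₁ ∧
           hk p 3 (tGL p 3 ![0, -1]) R₁ f = f₁ ∧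
           hk p 3 (wS p 3 (Equiv.swap (0 : Fin 3) 1) ![0, -1]) R₀ (hk p 3 (wS p 3 (Equiv.swap (0 : Fin 3) 1) ![0, -1]) R₀ f) = f₂ ∧
           hk p 3 (tGL p 3 ![-1, -1]) R₂ f = f₂)) := by
  refine ⟨fun a ha f f₁ f₂ hf hf₁ hf₂ R₀ Rω R₁ R₂ hR₀ hRω hR₁ hR₂ => ?_,
    fun a ha f f₁ f₂ hf hf₁ hf₂ R₀ Rω R₁ R₂ hR₀ hRω hR₁ hR₂ => ?_⟩
  · obtain ⟨h01, h1⟩ := le_of_mem_Sset_one ha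
    have hf := hf.isStdAt_one h01
    have hf₁ := hf₁.isStdAt_one (show a 0 - 1 ≤ a 1 by lia)
    have hf₂ := hf₂.isStdAt_one (show a 0 - 1 ≤ a 1 - 1 by lia)
    have e : tGL p 3 a * wS p 3 (Equiv.swap 0 1) ![0, -1] =
        wS p 3 (Equiv.swap 0 1) ![a 1, a 0 - 1] := by
      rw [tGL_mul_wS_swap]
      simp [sub_eq_add_neg]
    have ew : wS p 3 (Equiv.swap 0 1) ![0, -1] * permGL p 3 (Equiv.swap 0 1) =
        tGL p 3 ![-1, 0] := wS_swap_mul_permGL_swap _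
    have e₁ : tGL p 3 a * tGL p 3 ![-1, 0] = tGL p 3 ![a 0 - 1, a 1] := by
      rw [tGL_mul_tGL]
      simp [sub_eq_add_neg]
    have e₂ : tGL p 3 a * tGL p 3 ![-1, -1] = tGL p 3 ![a 0 - 1, a 1 - 1] := by
      rw [tGL_mul_tGL]
      simp [sub_eq_add_neg]
    have eg : wS p 3 (Equiv.swap 0 1) ![0, -1] * wS p 3 (Equiv.swap 0 1) ![0, -1] =
        tGL p 3 ![-1, -1] := wS_swap_mul_wS_swap _ _
    have A := isAdditive_tGL_wS (p := p) (h01.trans h1)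
    have B : IsAdditive (tGL p 3 a * wS p 3 (Equiv.swap 0 1) ![0, -1])
        (permGL p 3 (Equiv.swap 0 1)) := by
      rw [e]
      exact isAdditive_wS_permGL (show a 0 - 1 < a 1 by lia)
    have C : IsAdditive (tGL p 3 a * wS p 3 (Equiv.swap 0 1) ![0, -1])
        (wS p 3 (Equiv.swap 0 1) ![0, -1]) := by
      rw [e]
      exact isAdditive_wS_wS h1
    rw [← e₁, ← ew] at hf₁
    rw [← e₂, ← eg] at hf₂
    rw [← ew] at hR₁ ⊢
    rw [← eg] at hR₂ ⊢
    refine ⟨?_, (hf.hk (A.mul B) hR₁).unique hf₁, ?_, (hf.hk (A.mul C) hR₂).unique hf₂⟩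
    · rw [← mul_assoc] at hf₁
      exact ((hf.hk A hR₀).hk B hRω).unique hf₁
    · rw [← mul_assoc] at hf₂
      exact ((hf.hk A hR₀).hk C hR₀).unique hf₂
  · obtain ⟨h01, h0⟩ := lt_of_mem_Sset_swap ha
    have hf := hf.isStdAt_swap h01
    have hf₁ := hf₁.isStdAt_swap (show a 1 - 1 < a 0 by lia)
    have hf₂ := hf₂.isStdAt_swap (show a 1 - 1 < a 0 - 1 by lia)
    have e : wS p 3 (Equiv.swap 0 1) a * wS p 3 (Equiv.swap 0 1) ![0, -1] =
        tGL p 3 ![a 1, a 0 - 1] := by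
      rw [wS_swap_mul_wS_swap]
      simp [sub_eq_add_neg]
    have e' : wS p 3 (Equiv.swap 0 1) a * permGL p 3 (Equiv.swap 0 1) = tGL p 3 ![a 1, a 0] :=
      wS_swap_mul_permGL_swap a
    have ew : permGL p 3 (Equiv.swap 0 1) * wS p 3 (Equiv.swap 0 1) ![0, -1] =
        tGL p 3 ![0, -1] := by
      rw [wS, ← mul_assoc, permGL_swap_mul_self, one_mul]
    have e₁ : wS p 3 (Equiv.swap 0 1) a * tGL p 3 ![0, -1] =
        wS p 3 (Equiv.swap 0 1) ![a 0, a 1 - 1] := by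
      rw [wS, mul_assoc, tGL_mul_tGL, wS]
      simp [sub_eq_add_neg]
    have e₂ : wS p 3 (Equiv.swap 0 1) a * tGL p 3 ![-1, -1] =
        wS p 3 (Equiv.swap 0 1) ![a 0 - 1, a 1 - 1] := by
      rw [wS, mul_assoc, tGL_mul_tGL, wS]
      simp [sub_eq_add_neg]
    have eg : wS p 3 (Equiv.swap 0 1) ![0, -1] * wS p 3 (Equiv.swap 0 1) ![0, -1] =
        tGL p 3 ![-1, -1] := wS_swap_mul_wS_swap _ _
    have A := isAdditive_wS_permGL (p := p) h01
    have B : IsAdditive (wS p 3 (Equiv.swap 0 1) a * permGL p 3 (Equiv.swap 0 1))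
        (wS p 3 (Equiv.swap 0 1) ![0, -1]) := by
      rw [e']
      exact isAdditive_tGL_wS (show a 1 ≤ 0 by lia)
    have A' := isAdditive_wS_wS (p := p) h0
    have C : IsAdditive (wS p 3 (Equiv.swap 0 1) a * wS p 3 (Equiv.swap 0 1) ![0, -1])
        (wS p 3 (Equiv.swap 0 1) ![0, -1]) := by
      rw [e]
      exact isAdditive_tGL_wS (show a 1 ≤ 0 by lia)
    rw [← e₁, ← ew] at hf₁
    rw [← e₂, ← eg] at hf₂
    rw [← ew] at hR₁ ⊢
    rw [← eg] at hR₂ ⊢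
    refine ⟨?_, (hf.hk (A.mul B) hR₁).unique hf₁, ?_, (hf.hk (A'.mul C) hR₂).unique hf₂⟩
    · rw [← mul_assoc] at hf₁
      exact ((hf.hk A hRω).hk B hR₀).unique hf₁
    · rw [← mul_assoc] at hf₂
      exact ((hf.hk A' hR₀).hk C hR₀).unique hf₂

end IH
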